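/- arXiv:2309.04299 — 2 statements merged into one kernel-verified Lean document; each statement's English description precedes it below -/
import Mathlib

section
/- Let Z be in the Siegel half-space H_n and set R = φ(Z) = (Z − iI)(Z + iI)^{-1}. Then Im Z = (I − R)^{-1} (I − R·conj(R)) (I − conj(R))^{-1}, and consequently I − R·conj(R) is positive definite, i.e. φ maps H_n into D_n. -/
noncomputable section
open Matrix Complex
open scoped ComplexOrder

/-- Entrywise complex conjugation of a matrix. -/
def mconj {n : ℕ} (A : Matrix (Fin n) (Fin n) ℂ) : Matrix (Fin n) (Fin n) ℂ :=
  A.map (starRingEnd ℂ)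

/-- The imaginary part `Im Z = (Z - conj Z)/(2i)` of a complex matrix. -/
def imPart {n : ℕ} (Z : Matrix (Fin n) (Fin n) ℂ) : Matrix (Fin n) (Fin n) ℂ :=
  (2 * Complex.I)⁻¹ • (Z - mconj Z)

/-- Membership in the Siegel half-space `H_n`. -/
def inSiegel {n : ℕ} (Z : Matrix (Fin n) (Fin n) ℂ) : Prop :=
  Z.IsSymm ∧ (imPart Z).PosDef

/-- The Cayley transform `φ(Z) = (Z - iI)(Z + iI)⁻¹`. -/
def phi {n : ℕ} (Z : Matrix (Fin n) (Fin n) ℂ) : Matrix (Fin n) (Fin n) ℂ :=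
  (Z - Complex.I • 1) * (Z + Complex.I • 1)⁻¹

theorem mconj_eq_conjTranspose {n : ℕ} {A : Matrix (Fin n) (Fin n) ℂ} (hA : A.IsSymm) :
    mconj A = Aᴴ := by
  rw [conjTranspose, hA.eq]
  rfl

theorem isSymm_add_smul_one {n : ℕ} {Z : Matrix (Fin n) (Fin n) ℂ} (hZ : Z.IsSymm) (c : ℂ) :
    (Z + c • 1).IsSymm :=
  hZ.add (isSymm_one.smul c)

theorem isUnit_add_I_smul_one {n : ℕ} {Z : Matrix (Fin n) (Fin n) ℂ} (hZ : inSiegel Z) :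
    IsUnit (Z + Complex.I • 1) := by
  rw [← mulVec_injective_iff_isUnit, ← coe_mulVecLin, ← LinearMap.ker_eq_bot,
    LinearMap.ker_eq_bot']
  intro v hv
  have hZv : Z *ᵥ v = -(Complex.I • v) := by
    rw [mulVecLin_apply, add_mulVec, smul_mulVec, one_mulVec] at hv
    exact eq_neg_of_add_eq_zero_left hv
  by_contra hne
  have hpos := hZ.2.dotProduct_mulVec_pos hne
  have hstar : star v ⬝ᵥ (Zᴴ *ᵥ v) = Complex.I * (star v ⬝ᵥ v) := by
    rw [dotProduct_mulVec, ← star_mulVec, hZv]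
    simp
  have him : star v ⬝ᵥ (imPart Z *ᵥ v) = -(star v ⬝ᵥ v) := by
    rw [imPart, mconj_eq_conjTranspose hZ.1, smul_mulVec, sub_mulVec, dotProduct_smul,
      dotProduct_sub, hstar, hZv, dotProduct_neg, dotProduct_smul, smul_eq_mul, smul_eq_mul]
    field_simp
    ring
  rw [him] at hpos
  exact (neg_pos.mp hpos).not_ge (dotProduct_star_self_nonneg v)

theorem phi_eq_one_sub {n : ℕ} {Z : Matrix (Fin n) (Fin n) ℂ}
    (hP : IsUnit (Z + Complex.I • 1)) :
    phi Z = 1 - (2 * Complex.I) • (Z + Complex.I • 1)⁻¹ := by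
  have hd := (isUnit_iff_isUnit_det _).mp hP
  have hQ : Z - Complex.I • 1 = (Z + Complex.I • 1) - (2 * Complex.I) • 1 := by
    module
  rw [phi, hQ, sub_mul, mul_nonsing_inv _ hd, smul_mul, one_mul]

theorem mconj_phi_eq_one_add {n : ℕ} {Z : Matrix (Fin n) (Fin n) ℂ} (hZ : inSiegel Z) :
    mconj (phi Z) = 1 + (2 * Complex.I) • ((Z + Complex.I • 1)ᴴ)⁻¹ := by
  have hP := isUnit_add_I_smul_one hZ
  have hsymm : (phi Z).IsSymm := by
    rw [phi_eq_one_sub hP]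
    refine isSymm_one.sub (IsSymm.smul ?_ _)
    rw [IsSymm, transpose_nonsing_inv, (isSymm_add_smul_one hZ.1 _).eq]
  rw [mconj_eq_conjTranspose hsymm, phi_eq_one_sub hP, ← conjTranspose_nonsing_inv]
  simp

theorem one_sub_phi_mul_mconj_phi {n : ℕ} {Z : Matrix (Fin n) (Fin n) ℂ} (hZ : inSiegel Z) :
    1 - phi Z * mconj (phi Z) =
      (4 : ℂ) • ((Z + Complex.I • 1)⁻¹ * imPart Z * ((Z + Complex.I • 1)ᴴ)⁻¹) := by
  have hP := isUnit_add_I_smul_one hZ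
  rw [mconj_phi_eq_one_add hZ, phi_eq_one_sub hP]
  have hY : imPart Z = (2 * Complex.I)⁻¹ • ((Z + Complex.I • 1) - (Z + Complex.I • 1)ᴴ
      - (2 * Complex.I) • 1) := by
    rw [imPart, mconj_eq_conjTranspose hZ.1]
    congr 1
    simp only [conjTranspose_add, conjTranspose_smul, conjTranspose_one, star_def, conj_I]
    module
  rw [hY]
  generalize Z + Complex.I • 1 = P at hP
  have hd := (isUnit_iff_isUnit_det _).mp hP
  have hd' := (isUnit_iff_isUnit_det _).mp ((isUnit_conjTranspose P).mpr hP)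
  have hmid : P⁻¹ * (P - Pᴴ - (2 * Complex.I) • 1) * Pᴴ⁻¹
      = Pᴴ⁻¹ - P⁻¹ - (2 * Complex.I) • (P⁻¹ * Pᴴ⁻¹) := by
    rw [Matrix.mul_sub, Matrix.mul_sub, Matrix.sub_mul, Matrix.sub_mul, nonsing_inv_mul _ hd,
      one_mul, mul_nonsing_inv_cancel_right _ _ hd', Matrix.mul_smul, mul_one, Matrix.smul_mul]
  have hI : (2 * Complex.I)⁻¹ = -(2 * Complex.I) / 4 := by
    field_simp
    simp
    norm_num
  rw [Matrix.mul_smul, Matrix.smul_mul, hmid, Matrix.sub_mul, one_mul, Matrix.smul_mul,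
    Matrix.mul_add, Matrix.mul_smul, mul_one, hI]
  module

/-- For `Z` in the Siegel half-space and `R = φ(Z)`:
`Im Z = (I − R)⁻¹ (I − R·conj R) (I − conj R)⁻¹`, and consequently `I − R·conj R` is
positive definite, i.e. `φ` maps `H_n` into the matrix disk `D_n`. -/
theorem cayley_maps_into_disk {n : ℕ} (Z : Matrix (Fin n) (Fin n) ℂ)
    (hZ : inSiegel Z) :
    imPart Z
      = (1 - phi Z)⁻¹ * (1 - phi Z * mconj (phi Z)) * (1 - mconj (phi Z))⁻¹ ∧
    ((1 : Matrix (Fin n) (Fin n) ℂ) - phi Z * mconj (phi Z)).PosDef := by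
  have hP := isUnit_add_I_smul_one hZ
  have hd := (isUnit_iff_isUnit_det _).mp hP
  have hd' := (isUnit_iff_isUnit_det _).mp ((isUnit_conjTranspose _).mpr hP)
  rw [one_sub_phi_mul_mconj_phi hZ]
  constructor
  · have h₁ : (1 - phi Z)⁻¹ = (2 * Complex.I)⁻¹ • (Z + Complex.I • 1) := by
      refine inv_eq_left_inv ?_
      rw [phi_eq_one_sub hP, sub_sub_cancel, smul_mul_smul_comm, mul_nonsing_inv _ hd,
        inv_mul_cancel₀ (by simp), one_smul]
    have h₂ : (1 - mconj (phi Z))⁻¹ = (-(2 * Complex.I)⁻¹) • (Z + Complex.I • 1)ᴴ := by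
      refine inv_eq_left_inv ?_
      rw [mconj_phi_eq_one_add hZ, sub_add_cancel_left, ← neg_smul, smul_mul_smul_comm,
        mul_nonsing_inv _ hd', neg_mul_neg, inv_mul_cancel₀ (by simp), one_smul]
    rw [h₁, h₂, smul_mul_smul_comm, smul_mul_smul_comm, mul_assoc (Z + Complex.I • 1)⁻¹,
      mul_nonsing_inv_cancel_left _ _ hd, nonsing_inv_mul_cancel_right _ _ hd']
    have hc : (2 * Complex.I)⁻¹ * 4 * -(2 * Complex.I)⁻¹ = 1 := by
      field_simp
      simp
      norm_num
    rw [hc, one_smul]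
  · refine PosDef.smul ?_ (by norm_num)
    rw [← conjTranspose_nonsing_inv]
    refine hZ.2.mul_mul_conjTranspose_same ?_
    rw [vecMul_injective_iff_isUnit]
    exact isUnit_nonsing_inv_iff.mpr hP
end
end

section
/- Let R be an n×n complex symmetric matrix with I − R·conj(R) positive definite, and set Y = (I − R)^{-1}(I − R·conj(R))(I − conj(R))^{-1} (so Y is real symmetric positive definite). Then for every n×n complex matrix W, setting V = 2i(I − R)^{-1} W (I − R)^{-1}, one has Tr(Y^{-1} V Y^{-1} conj(V)) = 4 Tr((I − R·conj(R))^{-1} W (I − conj(R)·R)^{-1} conj(W)). (This expresses that the Siegel metric g_H = Tr(Y^{-1} dZ Y^{-1} d conj(Z)) transforms under the Cayley map into g_D = 4 Tr((I − R·conj(R))^{-1} dR (I − conj(R)·R)^{-1} d conj(R)).) -/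
noncomputable section
open Matrix Complex
open scoped ComplexOrder

theorem mconj_mul {n : ℕ} (A B : Matrix (Fin n) (Fin n) ℂ) :
    mconj (A * B) = mconj A * mconj B :=
  Matrix.map_mul

theorem mconj_one_sub {n : ℕ} (A : Matrix (Fin n) (Fin n) ℂ) :
    mconj (1 - A) = 1 - mconj A := by
  ext i j
  by_cases h : i = j <;> simp [mconj, h]

theorem mconj_smul {n : ℕ} (c : ℂ) (A : Matrix (Fin n) (Fin n) ℂ) :
    mconj (c • A) = starRingEnd ℂ c • mconj A := by
  ext i j
  simp [mconj]

theorem det_mconj {n : ℕ} (A : Matrix (Fin n) (Fin n) ℂ) :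
    (mconj A).det = starRingEnd ℂ A.det :=
  (RingHom.map_det (starRingEnd ℂ) A).symm

theorem mconj_inv {n : ℕ} {A : Matrix (Fin n) (Fin n) ℂ} (hA : IsUnit A.det) :
    mconj A⁻¹ = (mconj A)⁻¹ := by
  symm
  apply Matrix.inv_eq_left_inv
  rw [← mconj_mul, Matrix.nonsing_inv_mul A hA]
  exact Matrix.map_one _ (map_zero _) (map_one _)

/-- If `I - R * Rᴴ` is positive definite, then `1` is not an eigenvalue of `Rᴴ`. -/
theorem isUnit_det_one_sub_conjTranspose {n : ℕ} {R : Matrix (Fin n) (Fin n) ℂ}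
    (hpos : ((1 : Matrix (Fin n) (Fin n) ℂ) - R * Rᴴ).PosDef) :
    IsUnit (1 - Rᴴ).det := by
  rw [isUnit_iff_ne_zero]
  intro h
  obtain ⟨x, hx, hx0⟩ := Matrix.exists_mulVec_eq_zero_iff.mpr h
  have hfix : Rᴴ *ᵥ x = x := by
    rw [Matrix.sub_mulVec, Matrix.one_mulVec, sub_eq_zero] at hx0
    exact hx0.symm
  have hfix' : star x ᵥ* R = star x := by
    have := congrArg star hfix
    rwa [Matrix.star_mulVec, Matrix.conjTranspose_conjTranspose] at this
  have hlt := hpos.dotProduct_mulVec_pos hx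
  rw [Matrix.sub_mulVec, Matrix.one_mulVec, ← Matrix.mulVec_mulVec, hfix, dotProduct_sub,
    Matrix.dotProduct_mulVec, hfix', sub_self] at hlt
  exact lt_irrefl _ hlt

/-- Both sides equal `(1 - R)⁻¹ + (1 - S)⁻¹ - 1`. -/
theorem inv_one_sub_mul_comm {n : ℕ} {R S : Matrix (Fin n) (Fin n) ℂ}
    (hR : IsUnit (1 - R).det) (hS : IsUnit (1 - S).det) :
    (1 - R)⁻¹ * (1 - R * S) * (1 - S)⁻¹ = (1 - S)⁻¹ * (1 - S * R) * (1 - R)⁻¹ := by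
  have key : ∀ {P Q : Matrix (Fin n) (Fin n) ℂ}, IsUnit (1 - P).det → IsUnit (1 - Q).det →
      (1 - P)⁻¹ * (1 - P * Q) * (1 - Q)⁻¹ = (1 - P)⁻¹ + (1 - Q)⁻¹ - 1 := by
    intro P Q hP hQ
    have e : 1 - P * Q = (1 - P) + (1 - Q) - (1 - P) * (1 - Q) := by noncomm_ring
    rw [e, mul_sub, mul_add, sub_mul, add_mul, Matrix.nonsing_inv_mul _ hP, one_mul,
      Matrix.nonsing_inv_mul_cancel_left _ _ hP, Matrix.mul_nonsing_inv _ hQ,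
      Matrix.mul_nonsing_inv_cancel_right _ _ hQ, add_comm]
  rw [key hR hS, key hS hR, add_comm]

/-- The Siegel metric transforms under the Cayley map into the disk metric:
if `Y = (I − R)⁻¹(I − R·conj R)(I − conj R)⁻¹` and `V = 2i (I − R)⁻¹ W (I − R)⁻¹`,
then `Tr(Y⁻¹ V Y⁻¹ conj V) = 4 Tr((I − R·conj R)⁻¹ W (I − conj R·R)⁻¹ conj W)`. -/
theorem metric_transforms {n : ℕ} (R : Matrix (Fin n) (Fin n) ℂ)
    (hsymm : R.IsSymm)
    (hpos : ((1 : Matrix (Fin n) (Fin n) ℂ) - R * mconj R).PosDef)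
    (Y : Matrix (Fin n) (Fin n) ℂ)
    (hY : Y = (1 - R)⁻¹ * (1 - R * mconj R) * (1 - mconj R)⁻¹)
    (W : Matrix (Fin n) (Fin n) ℂ)
    (V : Matrix (Fin n) (Fin n) ℂ)
    (hV : V = (2 * Complex.I) • ((1 - R)⁻¹ * W * (1 - R)⁻¹)) :
    (Y⁻¹ * V * Y⁻¹ * mconj V).trace
      = 4 * ((1 - R * mconj R)⁻¹ * W * (1 - mconj R * R)⁻¹ * mconj W).trace := by
  have hstar : mconj R = Rᴴ := by
    conv_rhs => rw [← hsymm.eq]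
    ext i j
    simp [mconj]
  have hB : IsUnit (1 - mconj R).det := by
    rw [hstar] at hpos ⊢
    exact isUnit_det_one_sub_conjTranspose hpos
  have hA : IsUnit (1 - R).det := by
    rw [← mconj_one_sub, det_mconj] at hB
    simpa using hB
  have hY₁ : Y⁻¹ = (1 - mconj R) * (1 - R * mconj R)⁻¹ * (1 - R) := by
    rw [hY, Matrix.mul_inv_rev, Matrix.mul_inv_rev, Matrix.nonsing_inv_nonsing_inv _ hA,
      Matrix.nonsing_inv_nonsing_inv _ hB, mul_assoc]
  have hY₂ : Y⁻¹ = (1 - R) * (1 - mconj R * R)⁻¹ * (1 - mconj R) := by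
    rw [hY, inv_one_sub_mul_comm hA hB, Matrix.mul_inv_rev, Matrix.mul_inv_rev,
      Matrix.nonsing_inv_nonsing_inv _ hA, Matrix.nonsing_inv_nonsing_inv _ hB, mul_assoc]
  have hV' : mconj V = (-(2 * Complex.I)) •
      ((1 - mconj R)⁻¹ * mconj W * (1 - mconj R)⁻¹) := by
    rw [hV, mconj_smul, mconj_mul, mconj_mul, mconj_inv hA, mconj_one_sub, map_mul,
      Complex.conj_I, map_ofNat, mul_neg]
  have hc : -(2 * Complex.I) * (2 * Complex.I) = 4 := by
    linear_combination -4 * Complex.I_mul_I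
  have hprod : Y⁻¹ * V * Y⁻¹ * mconj V = (4 : ℂ) • ((1 - mconj R) *
      ((1 - R * mconj R)⁻¹ * W * (1 - mconj R * R)⁻¹ * mconj W) * (1 - mconj R)⁻¹) := by
    rw [hV']
    nth_rewrite 2 [hY₂]
    rw [hY₁, hV]
    simp only [Matrix.mul_smul, Matrix.smul_mul, smul_smul, hc, mul_assoc,
      Matrix.mul_nonsing_inv_cancel_left _ _ hA, Matrix.nonsing_inv_mul_cancel_left _ _ hA,
      Matrix.mul_nonsing_inv_cancel_left _ _ hB]
  rw [hprod, Matrix.trace_smul, smul_eq_mul, Matrix.trace_mul_comm,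
    Matrix.nonsing_inv_mul_cancel_left _ _ hB]
end
end
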